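/- There exist an absolute constant C > 0 and d₀ ∈ ℕ such that the following holds for all d ≥ d₀, λ > 0 and β > 0. Set ᾱ := log((1+λ)/(1+λe^{−β})), and suppose that λ/(1+λ) ≥ C·(log d)/d + C·log(λd⁴)/(βd) and ᾱ ≥ C·(log d)/d + C·log(d(1+λ))·log(2+λ)/(βd). Then for every set Ψ ⊆ {0,1}^d \ {0̄} (where 0̄ is the all-zero vector), Z(Ψ) ≤ (1+λ)^d · e^{1/d³ − (1/2)·ᾱ·ℓ_Ψ}. -/

import Mathlib

open scoped Classical

noncomputable section

/-- The number of coordinates where `ψ` equals `true`. -/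
def wt {d : ℕ} (ψ : Fin d → Bool) : ℕ :=
  (Finset.univ.filter fun i => ψ i = true).card

/-- `Z(Ψ) = Σ_{ψ ∈ Ψ} λ^{|ψ|} (1 + λ e^{−β|ψ|})^d`. -/
def ZPsi (d : ℕ) (lam beta : ℝ) (Ψ : Finset (Fin d → Bool)) : ℝ :=
  ∑ ψ ∈ Ψ, lam ^ wt ψ * (1 + lam * Real.exp (-beta * (wt ψ : ℝ))) ^ d

/-- `ℓ_Ψ`, the number of coordinates vanishing on all of `Ψ`. -/
def ellPsi (d : ℕ) (Ψ : Finset (Fin d → Bool)) : ℕ :=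
  (Finset.univ.filter fun i : Fin d => ∀ ψ ∈ Ψ, ψ i = false).card

/-- `ᾱ = log((1+λ)/(1+λe^{−β}))`. -/
def abar (lam beta : ℝ) : ℝ :=
  Real.log ((1 + lam) / (1 + lam * Real.exp (-beta)))

theorem sum_wt_le {d : ℕ} (Ψ : Finset (Fin d → Bool)) (S : Finset (Fin d))
    (hS : ∀ ψ ∈ Ψ, ∀ i, ψ i = true → i ∈ S) (g : ℕ → ℝ) (hg : ∀ k, 0 ≤ g k) :
    ∑ ψ ∈ Ψ, g (wt ψ) ≤ ∑ k ∈ Finset.range (S.card + 1), (S.card.choose k : ℝ) * g k := by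
  have h1 : ∑ ψ ∈ Ψ, g (wt ψ)
      = ∑ T ∈ Ψ.image (fun ψ => Finset.univ.filter fun i => ψ i = true), g T.card := by
    rw [Finset.sum_image]
    · rfl
    · intro a _ b _ hab
      funext i
      have := congrArg (fun T => i ∈ T) hab
      simp only [Finset.mem_filter, Finset.mem_univ, true_and, eq_iff_iff] at this
      exact Bool.eq_iff_iff.2 this
  have h2 : ∑ T ∈ Ψ.image (fun ψ => Finset.univ.filter fun i => ψ i = true), g T.card
      ≤ ∑ T ∈ S.powerset, g T.card := by
    apply Finset.sum_le_sum_of_subset_of_nonneg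
    · intro T hT
      obtain ⟨ψ, hψ, rfl⟩ := Finset.mem_image.1 hT
      rw [Finset.mem_powerset]
      intro i hi
      exact hS ψ hψ i (Finset.mem_filter.1 hi).2
    · intro _ _ _
      exact hg _
  have h3 := Finset.sum_powerset_apply_card g (x := S)
  simp only [nsmul_eq_mul] at h3
  linarith

set_option maxHeartbeats 2000000 in
theorem key_bound (d k : ℕ) (hd : 2 ≤ d) (lam beta : ℝ) (hl : 0 < lam) (hb : 0 < beta)
    (H1 : 128 * Real.log d + 128 * Real.log (lam * (d : ℝ) ^ 4) / beta ≤ d * (lam / (1 + lam)))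
    (H2 : 128 * Real.log d + 128 * Real.log (d * (1 + lam)) * Real.log (2 + lam) / beta
      ≤ d * abar lam beta) (hk : 1 ≤ k) (hk2 : beta * k < Real.log (2 * (lam * (d : ℝ) ^ 4))) :
    (d.choose k : ℝ) * (lam ^ k * (1 + lam * Real.exp (-beta * (k : ℝ))) ^ d)
      ≤ (1 + lam) ^ d * Real.exp (-(1 / 2) * abar lam beta * d) * (1 / (4 * (d : ℝ) ^ 4)) := by
  have hd' : (2 : ℝ) ≤ d := by exact_mod_cast hd
  have hk' : (1 : ℝ) ≤ k := by exact_mod_cast hk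
  have hlog2 : Real.log 2 ≤ Real.log d := Real.log_le_log (by norm_num) hd'
  have hlog2' := Real.log_two_gt_d9
  set A : ℝ := 1 + lam * Real.exp (-beta * (k : ℝ)) with hA
  have hApos : 0 < A := by positivity
  set a : ℝ := Real.log ((1 + lam) / A) with ha
  have hAa : A = (1 + lam) * Real.exp (-a) := by
    rw [ha, Real.exp_neg, Real.exp_log (by positivity)]
    field_simp
  have hA1 : A ≤ 1 + lam * Real.exp (-beta) := by
    have : Real.exp (-beta * k) ≤ Real.exp (-beta) := Real.exp_le_exp.2 (by nlinarith)
    rw [hA]; gcongr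
  have haa : abar lam beta ≤ a := by
    unfold abar
    rw [ha]
    apply Real.log_le_log (by positivity)
    gcongr
  have hL1 : 0 < Real.log (d * (1 + lam)) := Real.log_pos (by nlinarith)
  have hL2 : 0 < Real.log (2 + lam) := Real.log_pos (by linarith)
  have hdpos : (0 : ℝ) < d := by linarith
  have hmain : (d.choose k : ℝ) * lam ^ k ≤ Real.exp (a * d / 4) := by
    by_cases hc : beta * k ≤ Real.log (2 + lam)
    · have h1 : (d.choose k : ℝ) * lam ^ k ≤ (d * (1 + lam)) ^ k := by
        rw [mul_pow]
        have : (d.choose k : ℝ) ≤ (d : ℝ) ^ k := by exact_mod_cast Nat.choose_le_pow d k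
        have h3 : lam ^ k ≤ (1 + lam) ^ k := by gcongr; linarith
        gcongr
      refine h1.trans ?_
      rw [← Real.exp_log (show 0 < (d * (1 + lam)) ^ k by positivity), Real.log_pow]
      apply Real.exp_le_exp.2
      have h4 : (k : ℝ) ≤ Real.log (2 + lam) / beta := by
        rw [le_div_iff₀ hb]; linarith
      have h5 := mul_le_mul_of_nonneg_left h4 hL1.le
      have h6 : 128 * Real.log (d * (1 + lam)) * Real.log (2 + lam) / beta
        = 128 * (Real.log (d * (1 + lam)) * (Real.log (2 + lam) / beta)) := by ring
      rw [h6] at H2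
      have h7 := mul_le_mul_of_nonneg_left haa hdpos.le
      have h8 : 0 ≤ (k : ℝ) * Real.log (d * (1 + lam)) := by positivity
      nlinarith
    · push Not at hc
      set p : ℝ := lam / (1 + lam) with hp
      have hp0 : 0 < p := by positivity
      have hp1 : p ≤ 1 := by rw [hp, div_le_one (by positivity)]; linarith
      set L : ℝ := Real.log (1 + lam / 2) with hL
      have hLa : L ≤ a := by
        rw [hL, ha]
        apply Real.log_le_log (by positivity)
        rw [le_div_iff₀ hApos]
        have : Real.exp (-beta * k) ≤ 1 / (2 + lam) := by
          rw [one_div, ← Real.exp_log (show 0 < 2 + lam by positivity), ← Real.exp_neg]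
          apply Real.exp_le_exp.2
          linarith
        have h2 : A ≤ 1 + lam * (1 / (2 + lam)) := by rw [hA]; gcongr
        calc (1 + lam / 2) * A ≤ (1 + lam / 2) * (1 + lam * (1 / (2 + lam))) := by gcongr
          _ = 1 + lam := by field_simp; ring
      have hpL : p ≤ 2 * L := by
        have := Real.one_sub_inv_le_log_of_pos (show 0 < 1 + lam / 2 by positivity)
        have h2 : p / 2 ≤ 1 - (1 + lam / 2)⁻¹ := by
          have : 1 - (1 + lam / 2)⁻¹ = lam / (2 + lam) := by field_simp; ring
          rw [this, hp, div_div]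
          gcongr
          linarith
        linarith
      have hL2' : Real.log (1 + lam) ≤ 2 * L := by
        have : 2 * L = Real.log ((1 + lam / 2) ^ 2) := by rw [Real.log_pow]; push_cast; rfl
        rw [this]
        apply Real.log_le_log (by positivity)
        nlinarith
      have hab : abar lam beta ≤ lam := by
        unfold abar
        have h1 : (1 + lam) / (1 + lam * Real.exp (-beta)) ≤ 1 + lam := by
          apply div_le_self (by positivity)
          have : 0 < lam * Real.exp (-beta) := by positivity
          linarith
        have h2 := Real.log_le_sub_one_of_pos
          (show 0 < (1 + lam) / (1 + lam * Real.exp (-beta)) by positivity)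
        linarith
      have hld : 2 ≤ lam * (d : ℝ) ^ 4 := by
        have h0 : 0 ≤ 128 * Real.log (d * (1 + lam)) * Real.log (2 + lam) / beta := by positivity
        have h1 : 2 ≤ d * lam := by nlinarith
        have h2 : (1 : ℝ) ≤ (d : ℝ) ^ 3 := one_le_pow₀ (by linarith)
        calc (2 : ℝ) ≤ (d * lam) * 1 := by linarith
          _ ≤ (d * lam) * (d : ℝ) ^ 3 := by gcongr
          _ = _ := by ring
      have hkd : 64 * (k : ℝ) ≤ d * p := by
        have h1 : Real.log (2 * (lam * (d : ℝ) ^ 4)) ≤ 2 * Real.log (lam * (d : ℝ) ^ 4) := by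
          rw [Real.log_mul (by norm_num) (by positivity)]
          have := Real.log_le_log (by norm_num) hld
          linarith
        have h2 : (k : ℝ) ≤ 2 * Real.log (lam * (d : ℝ) ^ 4) / beta := by
          rw [le_div_iff₀ hb]; linarith
        have h3 : 128 * Real.log (lam * (d : ℝ) ^ 4) / beta
          = 64 * (2 * Real.log (lam * (d : ℝ) ^ 4) / beta) := by ring
        linarith
      have hkle : k ≤ d := by
        have : (k : ℝ) ≤ d := by nlinarith
        exact_mod_cast this
      have hbin : (d.choose k : ℝ) * (p / 16) ^ k ≤ Real.exp (p / 16 * d) := by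
        have h1 : (d.choose k : ℝ) * (p / 16) ^ k ≤ (p / 16 + 1) ^ d := by
          rw [add_pow]
          have := Finset.single_le_sum
            (f := fun m => (p / 16) ^ m * 1 ^ (d - m) * (d.choose m : ℝ))
            (s := Finset.range (d + 1)) (fun i _ => by positivity)
            (Finset.mem_range.2 (Nat.lt_succ_of_le hkle))
          simp only [one_pow, mul_one] at this ⊢
          linarith
        refine h1.trans ?_
        rw [mul_comm (p / 16), Real.exp_nat_mul]
        gcongr
        exact Real.add_one_le_exp _
      have hlk : lam ^ k = (p / 16) ^ k * Real.exp (k * (Real.log 16 + Real.log (1 + lam))) := by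
        rw [← Real.log_mul (by norm_num) (by positivity), Real.exp_nat_mul,
          Real.exp_log (by positivity), ← mul_pow, hp]
        congr 1
        field_simp
      rw [hlk, ← mul_assoc]
      calc _ ≤ Real.exp (p / 16 * d) * Real.exp (k * (Real.log 16 + Real.log (1 + lam))) := by
            gcongr
        _ = Real.exp (p / 16 * d + k * (Real.log 16 + Real.log (1 + lam))) := by
            rw [Real.exp_add]
        _ ≤ _ := by
            apply Real.exp_le_exp.2
            have h16 : Real.log 16 ≤ 3 := by
              have : Real.log 16 = 4 * Real.log 2 := by
                rw [show (16 : ℝ) = 2 ^ 4 by norm_num, Real.log_pow]; norm_num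
              have := Real.log_two_lt_d9
              linarith
            have hL0 : 0 < L := by linarith
            have e1 : (k : ℝ) * Real.log 16 ≤ k * 3 := by gcongr
            have e2 : (k : ℝ) * Real.log (1 + lam) ≤ k * (2 * L) := by gcongr
            have e3 : 64 * (k : ℝ) * L ≤ d * L := by
              have : 64 * (k : ℝ) ≤ d := by nlinarith
              gcongr
            have e4 : d * p ≤ d * (2 * L) := by gcongr
            have e5 : d * L ≤ d * a := by gcongr
            have e6 : 0 < d * L := by positivity
            linarith
  have hsmall : Real.exp (-(a * d / 4)) ≤ 1 / (4 * (d : ℝ) ^ 4) := by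
    rw [one_div, Real.exp_neg]
    apply inv_anti₀ (by positivity)
    rw [← Real.exp_log (show 0 < 4 * (d : ℝ) ^ 4 by positivity)]
    apply Real.exp_le_exp.2
    have h4 : Real.log 4 = 2 * Real.log 2 := by
      rw [show (4 : ℝ) = 2 ^ 2 by norm_num, Real.log_pow]; norm_num
    rw [Real.log_mul (by norm_num) (by positivity), Real.log_pow, h4]
    have h0 : 0 ≤ 128 * Real.log (d * (1 + lam)) * Real.log (2 + lam) / beta := by positivity
    have h7 := mul_le_mul_of_nonneg_left haa hdpos.le
    push_cast
    linarith
  have hhalf : Real.exp (-(a * d / 2)) ≤ Real.exp (-(1 / 2) * abar lam beta * d) := by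
    apply Real.exp_le_exp.2
    have h7 := mul_le_mul_of_nonneg_left haa hdpos.le
    linarith
  have hAd : A ^ d = (1 + lam) ^ d * (Real.exp (-(a * d / 4)) * Real.exp (-(a * d / 2)) *
      Real.exp (-(a * d / 4))) := by
    rw [hAa, mul_pow, ← Real.exp_nat_mul, ← Real.exp_add, ← Real.exp_add]
    congr 2
    ring
  calc (d.choose k : ℝ) * (lam ^ k * A ^ d) = ((d.choose k : ℝ) * lam ^ k) * A ^ d := by ring
    _ ≤ Real.exp (a * d / 4) * A ^ d := by gcongr
    _ = (1 + lam) ^ d * Real.exp (-(a * d / 2)) * Real.exp (-(a * d / 4)) *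
          (Real.exp (a * d / 4) * Real.exp (-(a * d / 4))) := by rw [hAd]; ring
    _ = (1 + lam) ^ d * Real.exp (-(a * d / 2)) * Real.exp (-(a * d / 4)) := by
        rw [← Real.exp_add, add_neg_cancel, Real.exp_zero, mul_one]
    _ ≤ _ := by gcongr

theorem statement13 :
    ∃ (C : ℝ) (d₀ : ℕ), 0 < C ∧
      ∀ d : ℕ, d₀ ≤ d → ∀ lam beta : ℝ, 0 < lam → 0 < beta →
        C * Real.log d / d + C * Real.log (lam * (d : ℝ) ^ 4) / (beta * d) ≤ lam / (1 + lam) →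
        C * Real.log d / d
            + C * Real.log (d * (1 + lam)) * Real.log (2 + lam) / (beta * d) ≤ abar lam beta →
        ∀ Ψ : Finset (Fin d → Bool), (fun _ => false) ∉ Ψ →
          ZPsi d lam beta Ψ ≤
            (1 + lam) ^ d *
              Real.exp (1 / (d : ℝ) ^ 3 - (1 / 2) * abar lam beta * (ellPsi d Ψ : ℝ)) := by
  refine ⟨128, 2, by norm_num, ?_⟩
  intro d hd lam beta hl hb H1 H2 Ψ hΨ
  have hd' : (2 : ℝ) ≤ d := by exact_mod_cast hd
  have hdpos : (0 : ℝ) < d := by linarith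
  have H1' : 128 * Real.log d + 128 * Real.log (lam * (d : ℝ) ^ 4) / beta
      ≤ d * (lam / (1 + lam)) := by
    have := mul_le_mul_of_nonneg_left H1 hdpos.le
    refine le_trans (le_of_eq ?_) this
    field_simp
  have H2' : 128 * Real.log d + 128 * Real.log (d * (1 + lam)) * Real.log (2 + lam) / beta
      ≤ d * abar lam beta := by
    have := mul_le_mul_of_nonneg_left H2 hdpos.le
    refine le_trans (le_of_eq ?_) this
    field_simp
  set x : ℝ := 1 / (2 * (d : ℝ) ^ 3) with hx
  have hx0 : 0 < x := by positivity
  set W : ℝ := (1 + lam) ^ d * Real.exp (-(1 / 2) * abar lam beta * d) * (1 / (4 * (d : ℝ) ^ 4))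
    with hW
  have hW0 : 0 < W := by positivity
  have hab0 : 0 ≤ abar lam beta := by
    unfold abar
    apply Real.log_nonneg
    rw [one_le_div (by positivity)]
    have : Real.exp (-beta) ≤ 1 := Real.exp_le_one_iff.2 (by linarith)
    nlinarith
  have habL : abar lam beta ≤ Real.log (1 + lam) := by
    unfold abar
    apply Real.log_le_log (by positivity)
    apply div_le_self (by positivity)
    have : 0 < lam * Real.exp (-beta) := by positivity
    linarith
  have hterm : ∀ ψ ∈ Ψ, lam ^ wt ψ * (1 + lam * Real.exp (-beta * (wt ψ : ℝ))) ^ d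
      ≤ lam ^ wt ψ * Real.exp x + W * ((d.choose (wt ψ) : ℝ))⁻¹ := by
    intro ψ hψ
    have hk : 1 ≤ wt ψ := by
      rw [Nat.one_le_iff_ne_zero]
      intro h0
      apply hΨ
      convert hψ using 1
      funext i
      unfold wt at h0
      rw [Finset.card_eq_zero, Finset.filter_eq_empty_iff] at h0
      have := h0 (Finset.mem_univ i)
      simpa using this
    have hkd : wt ψ ≤ d := by
      unfold wt
      exact (Finset.card_le_univ _).trans (by simp)
    have hch : (0 : ℝ) < (d.choose (wt ψ) : ℝ) := by exact_mod_cast Nat.choose_pos hkd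
    generalize wt ψ = k at *
    by_cases hc : beta * k < Real.log (2 * (lam * (d : ℝ) ^ 4))
    · have := key_bound d k hd lam beta hl hb H1' H2' hk hc
      rw [← hW, mul_comm, ← le_div_iff₀ hch, div_eq_mul_inv] at this
      have h2 : 0 < lam ^ k * Real.exp x := by positivity
      linarith
    · push Not at hc
      have h1 : (1 + lam * Real.exp (-beta * (k : ℝ))) ^ d ≤ Real.exp x := by
        have e1 : Real.exp (-beta * (k : ℝ)) ≤ 1 / (2 * (lam * (d : ℝ) ^ 4)) := by
          rw [one_div, ← Real.exp_log (show 0 < 2 * (lam * (d : ℝ) ^ 4) by positivity),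
            ← Real.exp_neg]
          apply Real.exp_le_exp.2
          linarith
        have e2 : lam * Real.exp (-beta * (k : ℝ)) ≤ x / d := by
          calc _ ≤ lam * (1 / (2 * (lam * (d : ℝ) ^ 4))) := by gcongr
            _ = x / d := by rw [hx]; field_simp
        have e3 : 1 + lam * Real.exp (-beta * (k : ℝ)) ≤ Real.exp (x / d) := by
          have := Real.add_one_le_exp (x / d)
          linarith
        calc _ ≤ (Real.exp (x / d)) ^ d := by gcongr
          _ = Real.exp x := by
            rw [← Real.exp_nat_mul]
            congr 1
            field_simp
      have h2 : 0 ≤ W * ((d.choose k : ℝ))⁻¹ := by positivity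
      have h3 : lam ^ k * (1 + lam * Real.exp (-beta * (k : ℝ))) ^ d ≤ lam ^ k * Real.exp x := by
        gcongr
      linarith
  set l := ellPsi d Ψ with hl_def
  set S : Finset (Fin d) := Finset.univ.filter fun i : Fin d => ¬ ∀ ψ ∈ Ψ, ψ i = false with hS
  have hcard : l + S.card = d := by
    rw [hl_def, hS]
    unfold ellPsi
    rw [Finset.card_filter_add_card_filter_not]
    simp
  have hsum1 : ∑ ψ ∈ Ψ, lam ^ wt ψ ≤ (1 + lam) ^ S.card := by
    have := sum_wt_le Ψ S (by
      intro ψ hψ i hi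
      rw [hS, Finset.mem_filter]
      refine ⟨Finset.mem_univ _, fun h => ?_⟩
      have := h ψ hψ
      simp [hi] at this) (fun k => lam ^ k) (fun k => by positivity)
    refine this.trans (le_of_eq ?_)
    rw [add_comm 1 lam, add_pow]
    apply Finset.sum_congr rfl
    intro k _
    simp [mul_comm]
  have hsum2 : ∑ ψ ∈ Ψ, ((d.choose (wt ψ) : ℝ))⁻¹ ≤ d + 1 := by
    have := sum_wt_le Ψ Finset.univ (fun _ _ i _ => Finset.mem_univ i)
      (fun k => ((d.choose k : ℝ))⁻¹) (fun k => by positivity)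
    refine this.trans (le_of_eq ?_)
    rw [Finset.card_univ, Fintype.card_fin, Finset.sum_congr rfl (g := fun _ => (1 : ℝ))]
    · simp
    · intro k hk
      have : (0 : ℝ) < (d.choose k : ℝ) := by
        exact_mod_cast Nat.choose_pos (Nat.lt_succ_iff.1 (Finset.mem_range.1 hk))
      field_simp
  set E : ℝ := Real.exp (-(1 / 2) * abar lam beta * l) with hE
  have hE0 : 0 < E := Real.exp_pos _
  have hfirst : (1 + lam) ^ S.card ≤ (1 + lam) ^ d * E := by
    have h1 : 1 ≤ (1 + lam) ^ l * E := by
      rw [← Real.exp_log (show 0 < (1 + lam) ^ l by positivity), Real.log_pow, hE, ← Real.exp_add]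
      apply Real.one_le_exp
      have : (l : ℝ) * abar lam beta ≤ l * Real.log (1 + lam) := by gcongr
      have h0 : 0 ≤ (l : ℝ) * abar lam beta := by positivity
      linarith
    calc (1 + lam) ^ S.card = (1 + lam) ^ S.card * 1 := by ring
      _ ≤ (1 + lam) ^ S.card * ((1 + lam) ^ l * E) := by gcongr
      _ = (1 + lam) ^ (l + S.card) * E := by rw [pow_add]; ring
      _ = _ := by rw [hcard]
  have hsecond : W * (d + 1) ≤ (1 + lam) ^ d * E * x := by
    have h1 : Real.exp (-(1 / 2) * abar lam beta * d) ≤ E := by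
      apply Real.exp_le_exp.2
      have : (l : ℝ) ≤ d := by
        have : l ≤ d := by omega
        exact_mod_cast this
      have := mul_le_mul_of_nonneg_left this hab0
      linarith
    have h2 : (1 / (4 * (d : ℝ) ^ 4)) * (d + 1) ≤ x := by
      rw [hx, div_mul_eq_mul_div, div_le_div_iff₀ (by positivity) (by positivity)]
      have : (0 : ℝ) < (d : ℝ) ^ 3 := by positivity
      nlinarith
    rw [hW, mul_assoc]
    gcongr
  have hexp : Real.exp x + x ≤ Real.exp (1 / (d : ℝ) ^ 3) := by
    have h1 : 1 / (d : ℝ) ^ 3 = x + x := by rw [hx]; field_simp; norm_num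
    rw [h1, Real.exp_add]
    have := Real.add_one_le_exp x
    nlinarith
  unfold ZPsi
  calc _ ≤ ∑ ψ ∈ Ψ, (lam ^ wt ψ * Real.exp x + W * ((d.choose (wt ψ) : ℝ))⁻¹) :=
        Finset.sum_le_sum hterm
    _ = (∑ ψ ∈ Ψ, lam ^ wt ψ) * Real.exp x + W * ∑ ψ ∈ Ψ, ((d.choose (wt ψ) : ℝ))⁻¹ := by
        rw [Finset.sum_add_distrib, Finset.sum_mul, Finset.mul_sum]
    _ ≤ ((1 + lam) ^ d * E) * Real.exp x + W * (d + 1) := by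
        gcongr
        exact hsum1.trans hfirst
    _ ≤ ((1 + lam) ^ d * E) * (Real.exp x + x) := by linarith
    _ ≤ ((1 + lam) ^ d * E) * Real.exp (1 / (d : ℝ) ^ 3) := by gcongr
    _ = _ := by
        rw [mul_assoc, hE, ← Real.exp_add]
        congr 2
        ring
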